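/- Optimal link structure: assume I and Ī are nonempty and fix E_in(I) and E_Ī such that every node of Ī has at least one outlink in E_in(I) ∪ E_Ī. Let (H, F) be an optimal pair and let v be computed in the graph H ∪ F ∪ E_in(I) ∪ E_Ī. Then there is a relabeling of the nodes of N under which I = {1, 2, …, n_I}, v_1 > v_2 > … > v_{n_I} > v_{n_I + 1} ≥ … ≥ v_n, H = {(i,j) ∈ I×I : j ≤ i or j = i+1}, and F = {(n_I, n_I + 1)}. -/

import Mathlib

open Matrix Finset

/-- Outdegree of node `i` in the edge set `E`. -/
def outdeg {n : ℕ} (E : Finset (Fin n × Fin n)) (i : Fin n) : ℕ :=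
  (Finset.univ.filter (fun j => (i, j) ∈ E)).card

/-- The scaled adjacency matrix `P` of the graph: `P i j = 1 / outdeg i` if `(i,j) ∈ E`. -/
noncomputable def Pmat {n : ℕ} (E : Finset (Fin n × Fin n)) : Matrix (Fin n) (Fin n) ℝ :=
  fun i j => if (i, j) ∈ E then ((outdeg E i : ℝ))⁻¹ else 0

/-- Indicator vector of a set of nodes. -/
def ind {n : ℕ} (I : Finset (Fin n)) : Fin n → ℝ :=
  fun i => if i ∈ I then 1 else 0

/-- `v = (Id - cP)⁻¹ e_I`, the vector of mean numbers of visits to `I` before zapping. -/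
noncomputable def vvec {n : ℕ} (c : ℝ) (E : Finset (Fin n × Fin n)) (I : Finset (Fin n)) : Fin n → ℝ :=
  (1 - c • Pmat E)⁻¹ *ᵥ ind I

/-- PageRank vector `πᵀ = (1-c) zᵀ (Id - cP)⁻¹`. -/
noncomputable def pr {n : ℕ} (c : ℝ) (z : Fin n → ℝ) (E : Finset (Fin n × Fin n)) : Fin n → ℝ :=
  (1 - c) • (((1 - c • Pmat E)⁻¹)ᵀ *ᵥ z)

/-- PageRank of the set `I`: `πᵀ e_I`. -/
noncomputable def prSet {n : ℕ} (c : ℝ) (z : Fin n → ℝ) (E : Finset (Fin n × Fin n))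
    (I : Finset (Fin n)) : ℝ :=
  ∑ i ∈ I, pr c z E i

/-- Node `i` has access to (some node of) the set `J`: `i ∈ J` or a directed path from `i`
reaches `J`. -/
def access {n : ℕ} (E : Finset (Fin n × Fin n)) (i : Fin n) (J : Finset (Fin n)) : Prop :=
  ∃ j ∈ J, Relation.ReflTransGen (fun a b => (a, b) ∈ E) i j

/-- A graph is admissible for `I` (Assumption A + well-definedness): every node has at
least one outlink and every node of `I` has access to the complement of `I`. -/
def admissible {n : ℕ} (E : Finset (Fin n × Fin n)) (I : Finset (Fin n)) : Prop :=
  (∀ i, 0 < outdeg E i) ∧ ∀ i ∈ I, access E i Iᶜ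

/-- set of out-neighbours -/
def outS {n : ℕ} (E : Finset (Fin n × Fin n)) (i : Fin n) : Finset (Fin n) :=
  Finset.univ.filter (fun j => (i, j) ∈ E)

/-- average of `w` over `S` -/
noncomputable def avgS {n : ℕ} (S : Finset (Fin n)) (w : Fin n → ℝ) : ℝ :=
  (S.card : ℝ)⁻¹ * ∑ j ∈ S, w j

theorem mem_outS {n : ℕ} (E : Finset (Fin n × Fin n)) (i j : Fin n) :
    j ∈ outS E i ↔ (i, j) ∈ E := by simp [outS]

theorem Pmul {n : ℕ} (E : Finset (Fin n × Fin n)) (w : Fin n → ℝ) (i : Fin n) :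
    (Pmat E *ᵥ w) i = avgS (outS E i) w := by
  simp only [Matrix.mulVec, dotProduct, Pmat, avgS, outS, outdeg, Finset.mul_sum, ite_mul, zero_mul]
  rw [Finset.sum_filter]

theorem lt_avgS {n : ℕ} (S : Finset (Fin n)) (w : Fin n → ℝ) (hS : S.Nonempty) (t : ℝ) :
    t < avgS S w ↔ (S.card : ℝ) * t < ∑ j ∈ S, w j := by
  have h : (0 : ℝ) < S.card := by exact_mod_cast hS.card_pos
  unfold avgS
  rw [inv_mul_eq_div, lt_div_iff₀ h, mul_comm]

theorem avgS_lt {n : ℕ} (S : Finset (Fin n)) (w : Fin n → ℝ) (hS : S.Nonempty) (t : ℝ) :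
    avgS S w < t ↔ ∑ j ∈ S, w j < (S.card : ℝ) * t := by
  have h : (0 : ℝ) < S.card := by exact_mod_cast hS.card_pos
  unfold avgS
  rw [inv_mul_eq_div, div_lt_iff₀ h, mul_comm]

theorem avgS_mul {n : ℕ} (S : Finset (Fin n)) (w : Fin n → ℝ) (hS : S.Nonempty) :
    ∑ j ∈ S, w j = (S.card : ℝ) * avgS S w := by
  have h : (0 : ℝ) < S.card := by exact_mod_cast hS.card_pos
  unfold avgS
  field_simp

theorem le_avgS {n : ℕ} (S : Finset (Fin n)) (w : Fin n → ℝ) (hS : S.Nonempty) (t : ℝ)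
    (h : ∀ j ∈ S, t ≤ w j) : t ≤ avgS S w := by
  by_contra! hh
  rw [avgS_lt S w hS] at hh
  have := Finset.card_nsmul_le_sum S w t h
  rw [nsmul_eq_mul] at this
  linarith

theorem avgS_lt_of {n : ℕ} (S : Finset (Fin n)) (w : Fin n → ℝ) (hS : S.Nonempty) (t : ℝ)
    (h : ∀ j ∈ S, w j ≤ t) (h' : ∃ j ∈ S, w j < t) : avgS S w < t := by
  rw [avgS_lt S w hS]
  have := Finset.sum_lt_sum h h'
  simpa using this

theorem exists_low {n : ℕ} (S : Finset (Fin n)) (w : Fin n → ℝ) (i : Fin n) (hi : i ∈ S)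
    (h : avgS S w < w i) : ∃ p ∈ S, w p < avgS S w := by
  by_contra! hh
  have h1 := Finset.sum_lt_sum hh ⟨i, hi, h⟩
  rw [avgS_mul S w ⟨i, hi⟩] at h1
  simp at h1

theorem avgS_insert {n : ℕ} (S : Finset (Fin n)) (w : Fin n → ℝ) (hS : S.Nonempty) (k : Fin n)
    (hk : k ∉ S) (h : avgS S w < w k) : avgS S w < avgS (insert k S) w := by
  rw [lt_avgS _ _ (Finset.insert_nonempty k S), Finset.sum_insert hk, Finset.card_insert_of_notMem hk,
    avgS_mul S w hS]
  push_cast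
  linarith

theorem avgS_erase {n : ℕ} (S : Finset (Fin n)) (w : Fin n → ℝ) (p : Fin n)
    (hp : p ∈ S) (hS : (S.erase p).Nonempty) (h : w p < avgS S w) :
    avgS S w < avgS (S.erase p) w := by
  rw [lt_avgS _ _ hS]
  have h1 := Finset.add_sum_erase S w hp
  have h2 := avgS_mul S w ⟨p, hp⟩
  have h3 := Finset.card_erase_add_one hp
  have h4 : ((S.erase p).card : ℝ) + 1 = S.card := by exact_mod_cast h3
  rw [← h4] at h2
  linarith

theorem avgS_swap {n : ℕ} (S : Finset (Fin n)) (w : Fin n → ℝ) (p b : Fin n)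
    (hp : p ∈ S) (hb : b ∉ S) (h : w p < w b) :
    avgS S w < avgS (insert b (S.erase p)) w := by
  have hb' : b ∉ S.erase p := fun hh => hb (Finset.mem_of_mem_erase hh)
  rw [lt_avgS _ _ (Finset.insert_nonempty _ _), Finset.sum_insert hb',
    Finset.card_insert_of_notMem hb', Finset.card_erase_add_one hp, ← avgS_mul S w ⟨p, hp⟩,
    ← Finset.add_sum_erase S w hp]
  linarith

theorem avgS_sub {n : ℕ} (S : Finset (Fin n)) (w u : Fin n → ℝ) :
    avgS S (fun x => w x - u x) = avgS S w - avgS S u := by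
  unfold avgS
  rw [Finset.sum_sub_distrib]; ring

theorem avgS_const {n : ℕ} (S : Finset (Fin n)) (hS : S.Nonempty) (t : ℝ) :
    avgS S (fun _ => t) = t := by
  have h : (0 : ℝ) < S.card := by exact_mod_cast hS.card_pos
  simp [avgS]
  field_simp

/-- minimum principle -/
theorem minprin {n : ℕ} (c : ℝ) (hc0 : 0 < c) (hc1 : c < 1) (E : Finset (Fin n × Fin n))
    (hE : ∀ i, (outS E i).Nonempty) (w : Fin n → ℝ)
    (h : ∀ i, c * avgS (outS E i) w ≤ w i) : ∀ i, 0 ≤ w i := by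
  intro i
  obtain ⟨m, -, hm⟩ := Finset.exists_min_image Finset.univ w ⟨i, Finset.mem_univ i⟩
  have h1 : w m ≤ avgS (outS E m) w := le_avgS _ _ (hE m) _ (fun j _ => hm j (Finset.mem_univ j))
  have h2 := h m
  have h3 := hm i (Finset.mem_univ i)
  have : 0 ≤ w m := by nlinarith
  linarith

theorem outS_nonempty {n : ℕ} {E : Finset (Fin n × Fin n)} {I : Finset (Fin n)}
    (hA : admissible E I) (i : Fin n) : (outS E i).Nonempty := Finset.card_pos.mp (hA.1 i)

theorem isUnit_mat {n : ℕ} (c : ℝ) (hc0 : 0 < c) (hc1 : c < 1) (E : Finset (Fin n × Fin n))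
    (hE : ∀ i, (outS E i).Nonempty) : IsUnit (1 - c • Pmat E) := by
  rw [← Matrix.mulVec_injective_iff_isUnit]
  have key : ∀ w : Fin n → ℝ, (1 - c • Pmat E) *ᵥ w = 0 → ∀ i, 0 ≤ w i := by
    intro w hw
    apply minprin c hc0 hc1 E hE
    intro i
    have := congrFun hw i
    rw [Matrix.sub_mulVec, Matrix.one_mulVec, Matrix.smul_mulVec] at this
    simp only [Pi.sub_apply, Pi.smul_apply, Pmul, smul_eq_mul, Pi.zero_apply] at this
    linarith
  intro x y hxy
  have h1 : (1 - c • Pmat E) *ᵥ (x - y) = 0 := by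
    rw [Matrix.mulVec_sub]; exact sub_eq_zero.mpr hxy
  have h2 : (1 - c • Pmat E) *ᵥ (y - x) = 0 := by
    rw [Matrix.mulVec_sub]; exact sub_eq_zero.mpr hxy.symm
  funext i
  have h3 := key _ h1 i
  have h4 := key _ h2 i
  simp only [Pi.sub_apply] at h3 h4
  linarith

theorem vvec_eq {n : ℕ} (c : ℝ) (hc0 : 0 < c) (hc1 : c < 1) (E : Finset (Fin n × Fin n))
    (hE : ∀ i, (outS E i).Nonempty) (I : Finset (Fin n)) (i : Fin n) :
    vvec c E I i = ind I i + c * avgS (outS E i) (vvec c E I) := by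
  have hu := isUnit_mat c hc0 hc1 E hE
  have h : (1 - c • Pmat E) *ᵥ vvec c E I = ind I := by
    unfold vvec
    rw [Matrix.mulVec_mulVec, Matrix.mul_nonsing_inv _ ((Matrix.isUnit_iff_isUnit_det _).mp hu),
      Matrix.one_mulVec]
  have := congrFun h i
  rw [Matrix.sub_mulVec, Matrix.one_mulVec, Matrix.smul_mulVec] at this
  simp only [Pi.sub_apply, Pi.smul_apply, Pmul, smul_eq_mul] at this
  linarith

theorem prSet_eq {n : ℕ} (c : ℝ) (z : Fin n → ℝ) (E : Finset (Fin n × Fin n))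
    (I : Finset (Fin n)) : prSet c z E I = (1 - c) * ∑ i, z i * vvec c E I i := by
  have h : prSet c z E I = ind I ⬝ᵥ pr c z E := by
    simp [prSet, dotProduct, ind]
  rw [h, pr, dotProduct_smul, Matrix.dotProduct_mulVec, Matrix.vecMul_transpose, smul_eq_mul,
    dotProduct_comm]
  rfl

/-- reach the set `J` in `m` steps -/
def reach {n : ℕ} (E : Finset (Fin n × Fin n)) (J : Finset (Fin n)) : ℕ → Fin n → Prop
  | 0, x => x ∈ J
  | m + 1, x => ∃ y, (x, y) ∈ E ∧ reach E J m y

theorem exists_dist {n : ℕ} (E : Finset (Fin n × Fin n)) (I : Finset (Fin n))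
    (hA : admissible E I) : ∃ d : Fin n → ℕ, (∀ x, d x = 0 ↔ x ∉ I) ∧
      ∀ x ∈ I, ∃ y, (x, y) ∈ E ∧ d y + 1 = d x := by
  classical
  have hr : ∀ x, ∃ m, reach E Iᶜ m x := by
    intro x
    have hx : access E x Iᶜ := by
      by_cases hx : x ∈ I
      · exact hA.2 x hx
      · exact ⟨x, by simpa using hx, Relation.ReflTransGen.refl⟩
    obtain ⟨j, hj, hp⟩ := hx
    induction hp using Relation.ReflTransGen.head_induction_on with
    | refl => exact ⟨0, hj⟩
    | head h _ ih =>
      obtain ⟨m, hm⟩ := ih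
      exact ⟨m + 1, _, h, hm⟩
  refine ⟨fun x => Nat.find (hr x), ?_, ?_⟩
  · intro x
    rw [Nat.find_eq_zero]
    simp [reach]
  · intro x hx
    have hs := Nat.find_spec (hr x)
    cases hm : Nat.find (hr x) with
    | zero =>
      rw [hm] at hs
      simp [reach] at hs
      exact absurd hx hs
    | succ m =>
      rw [hm] at hs
      obtain ⟨y, hy, hy'⟩ := hs
      refine ⟨y, hy, ?_⟩
      have h1 : Nat.find (hr y) ≤ m := Nat.find_min' _ hy'
      have h2 : Nat.find (hr x) ≤ Nat.find (hr y) + 1 :=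
        Nat.find_min' _ ⟨y, hy, Nat.find_spec (hr y)⟩
      show Nat.find (hr y) + 1 = Nat.find (hr x)
      omega

/-- replace outlinks of `i` by `S` -/
def chg {n : ℕ} (E : Finset (Fin n × Fin n)) (i : Fin n) (S : Finset (Fin n)) :
    Finset (Fin n × Fin n) :=
  Finset.univ.filter (fun q => (q.1 ≠ i ∧ q ∈ E) ∨ (q.1 = i ∧ q.2 ∈ S))

theorem outS_chg_self {n : ℕ} (E : Finset (Fin n × Fin n)) (i : Fin n) (S : Finset (Fin n)) :
    outS (chg E i S) i = S := by
  ext j; simp [outS, chg]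

theorem outS_chg_ne {n : ℕ} (E : Finset (Fin n × Fin n)) (i : Fin n) (S : Finset (Fin n))
    (x : Fin n) (hx : x ≠ i) : outS (chg E i S) x = outS E x := by
  ext j; simp [outS, chg, hx]

theorem adm_chg {n : ℕ} (E : Finset (Fin n × Fin n)) (I : Finset (Fin n))
    (hA : admissible E I) (d : Fin n → ℕ) (hd0 : ∀ x, d x = 0 ↔ x ∉ I)
    (hd : ∀ x ∈ I, ∃ y, (x, y) ∈ E ∧ d y + 1 = d x) (i : Fin n)
    (S : Finset (Fin n)) (k : Fin n) (hk : k ∈ S) (hki : k ≠ i) (hdk : d k ≤ d i) :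
    admissible (chg E i S) I := by
  have step : ∀ x y, (x, y) ∈ chg E i S → access (chg E i S) y Iᶜ → access (chg E i S) x Iᶜ := by
    rintro x y hxy ⟨j, hj, hp⟩
    exact ⟨j, hj, Relation.ReflTransGen.head hxy hp⟩
  have base : ∀ x, x ∉ I → access (chg E i S) x Iᶜ := fun x hx =>
    ⟨x, by simpa using hx, Relation.ReflTransGen.refl⟩
  have h1 : ∀ m x, d x = m → m ≤ d i → x ≠ i → access (chg E i S) x Iᶜ := by
    intro m
    induction m with
    | zero => intro x hx _ _; exact base x ((hd0 x).mp hx)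
    | succ m ih =>
      intro x hx hm hxi
      have hxI : x ∈ I := by
        by_contra h
        have := (hd0 x).mpr h
        omega
      obtain ⟨y, hy, hyd⟩ := hd x hxI
      refine step x y (by simp [chg, hxi, hy]) (ih y (by omega) (by omega) ?_)
      rintro rfl; omega
  have hi : access (chg E i S) i Iᶜ := step i k (by simp [chg, hk]) (h1 _ k rfl hdk hki)
  have h2 : ∀ m x, d x = m → access (chg E i S) x Iᶜ := by
    intro m
    induction m with
    | zero => intro x hx; exact base x ((hd0 x).mp hx)
    | succ m ih =>
      intro x hx
      by_cases hxi : x = i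
      · rw [hxi]; exact hi
      have hxI : x ∈ I := by
        by_contra h
        have := (hd0 x).mpr h
        omega
      obtain ⟨y, hy, hyd⟩ := hd x hxI
      exact step x y (by simp [chg, hxi, hy]) (ih y (by omega))
  refine ⟨fun x => ?_, fun x _ => h2 _ x rfl⟩
  show 0 < (outS (chg E i S) x).card
  apply Finset.card_pos.mpr
  by_cases hxi : x = i
  · rw [hxi, outS_chg_self]; exact ⟨k, hk⟩
  · rw [outS_chg_ne _ _ _ _ hxi]; exact outS_nonempty hA x

/-- If a one-node change does not increase the PageRank, it does not increase the average. -/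
theorem chg_le {n : ℕ} (c : ℝ) (hc0 : 0 < c) (hc1 : c < 1)
    (z : Fin n → ℝ) (hz : ∀ i, 0 < z i) (E : Finset (Fin n × Fin n)) (I : Finset (Fin n))
    (hA : admissible E I) (i : Fin n) (S : Finset (Fin n)) (hA' : admissible (chg E i S) I)
    (hle : prSet c z (chg E i S) I ≤ prSet c z E I) :
    avgS S (vvec c E I) ≤ avgS (outS E i) (vvec c E I) := by
  by_contra! hlt
  rw [prSet_eq, prSet_eq] at hle
  have hle2 := le_of_mul_le_mul_left hle (by linarith)
  have hv := vvec_eq c hc0 hc1 E (outS_nonempty hA) I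
  have hv' := vvec_eq c hc0 hc1 _ (outS_nonempty hA') I
  set v := vvec c E I with hvdef
  set v' := vvec c (chg E i S) I with hvdef'
  have hw0 : ∀ x, c * avgS (outS (chg E i S) x) (fun x => v' x - v x) ≤ v' x - v x ∧
      (x = i → c * avgS (outS (chg E i S) x) (fun x => v' x - v x) < v' x - v x) := by
    intro x
    rw [avgS_sub]
    by_cases hx : x = i
    · subst hx
      have h1 := hv' x
      have h2 := hv x
      rw [outS_chg_self] at h1 ⊢
      have := mul_lt_mul_of_pos_left hlt hc0
      constructor
      · linarith
      · intro _; linarith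
    · have h1 := hv' x
      have h2 := hv x
      rw [outS_chg_ne _ _ _ _ hx] at h1 ⊢
      exact ⟨by linarith, fun h => absurd h hx⟩
  have hw := minprin c hc0 hc1 _ (outS_nonempty hA') _ (fun x => (hw0 x).1)
  have hi : 0 < v' i - v i := by
    refine lt_of_le_of_lt ?_ ((hw0 i).2 rfl)
    exact mul_nonneg hc0.le (le_avgS _ _ (outS_nonempty hA' i) _ (fun j _ => hw j))
  have : ∑ x, z x * v x < ∑ x, z x * v' x := by
    apply Finset.sum_lt_sum
    · intro x _
      have := hw x
      exact mul_le_mul_of_nonneg_left (by linarith) (hz x).le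
    · exact ⟨i, Finset.mem_univ i, mul_lt_mul_of_pos_left (by linarith) (hz i)⟩
  linarith

theorem v_bounds {n : ℕ} (c : ℝ) (hc0 : 0 < c) (hc1 : c < 1) (E : Finset (Fin n × Fin n))
    (I : Finset (Fin n)) (hA : admissible E I) (d : Fin n → ℕ) (hd0 : ∀ x, d x = 0 ↔ x ∉ I)
    (hd : ∀ x ∈ I, ∃ y, (x, y) ∈ E ∧ d y + 1 = d x) :
    (∀ x, vvec c E I x < (1 - c)⁻¹) ∧ (∀ x ∈ I, 1 ≤ vvec c E I x) ∧
    (∀ x ∈ I, avgS (outS E x) (vvec c E I) < vvec c E I x) := by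
  have hne := outS_nonempty hA
  have hv := vvec_eq c hc0 hc1 E hne I
  set v := vvec c E I with hvdef
  have hK : (1 - c) * (1 - c)⁻¹ = 1 := mul_inv_cancel₀ (by linarith)
  have hKpos : 0 < (1 - c)⁻¹ := inv_pos.mpr (by linarith)
  set K := (1 - c)⁻¹ with hKdef
  have hind : ∀ x, ind I x ≤ 1 ∧ 0 ≤ ind I x := by
    intro x; unfold ind; split_ifs <;> norm_num
  have h0 : ∀ x, 0 ≤ v x := minprin c hc0 hc1 E hne v (fun x => by
    have := hv x; have := (hind x).2; linarith)
  have hle : ∀ x, 0 ≤ K - v x := by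
    refine minprin c hc0 hc1 E hne (fun x => K - v x) (fun x => ?_)
    rw [avgS_sub (outS E x) (fun _ => K) v, avgS_const _ (hne x)]
    have := hv x; have := (hind x).1
    show c * (K - _) ≤ K - v x
    nlinarith
  have hlt : ∀ m x, d x = m → v x < K := by
    intro m
    induction m with
    | zero =>
      intro x hx
      have hxI := (hd0 x).mp hx
      have h1 := hv x
      have h2 : avgS (outS E x) v ≤ K := by
        have := le_avgS (outS E x) (fun x => K - v x) (hne x) 0 (fun j _ => hle j)
        rw [avgS_sub (outS E x) (fun _ => K) v, avgS_const _ (hne x)] at this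
        linarith
      simp [ind, hxI] at h1
      nlinarith
    | succ m ih =>
      intro x hx
      have hxI : x ∈ I := by
        by_contra h
        have := (hd0 x).mpr h
        omega
      obtain ⟨y, hy, hyd⟩ := hd x hxI
      have h1 := hv x
      have h2 : avgS (outS E x) v < K := avgS_lt_of _ _ (hne x) _
        (fun j _ => by have := hle j; linarith) ⟨y, (mem_outS _ _ _).mpr hy, ih y (by omega)⟩
      simp [ind, hxI] at h1
      nlinarith
  refine ⟨fun x => hlt _ x rfl, ?_, ?_⟩
  · intro x hx
    have h1 := hv x
    simp only [ind, hx, if_true] at h1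
    have := mul_nonneg hc0.le (le_avgS (outS E x) v (hne x) 0 (fun j _ => h0 j))
    linarith
  · intro x hx
    have h1 := hv x
    simp only [ind, hx, if_true] at h1
    have h2 : avgS (outS E x) v < K := by
      obtain ⟨y, hy⟩ := hne x
      exact avgS_lt_of _ _ (hne x) _
        (fun j _ => by have := hle j; linarith) ⟨y, hy, hlt _ y rfl⟩
    nlinarith

/-- The structure of an optimal graph, in terms of a distance function. -/
theorem opt_shape {n : ℕ} (E : Finset (Fin n × Fin n)) (I : Finset (Fin n))
    (v : Fin n → ℝ) (d : Fin n → ℕ) 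
    (hd : ∀ x ∈ I, ∃ y, (x, y) ∈ E ∧ d y + 1 = d x)
    (hv : ∀ x ∈ I, avgS (outS E x) v < v x)
    (hopt : ∀ i ∈ I, ∀ S : Finset (Fin n), ∀ k ∈ S, k ≠ i → d k ≤ d i →
      avgS S v ≤ avgS (outS E i) v) :
    ∀ i ∈ I, (∀ k, v i ≤ v k → (i, k) ∈ E) ∧ (∀ k, k ≠ i → v i ≤ v k → d i < d k) ∧
      ∃ p, (i, p) ∈ E ∧ v p < v i ∧ d p + 1 = d i ∧ ∀ k, (i, k) ∈ E → k ≠ i → k ≠ p → d i < d k := by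
  intro i hi
  obtain ⟨y, hy, hyd⟩ := hd i hi
  have hyi : y ≠ i := by rintro rfl; omega
  have hyS := (mem_outS _ _ _).mpr hy
  have hadd : ∀ k, v i ≤ v k → (i, k) ∈ E := by
    intro k hk
    by_contra hkE
    rw [← mem_outS] at hkE
    have h1 := avgS_insert (outS E i) v ⟨y, hyS⟩ k hkE (lt_of_lt_of_le (hv i hi) hk)
    have h2 := hopt i hi (insert k (outS E i)) y (Finset.mem_insert_of_mem hyS) hyi (by omega)
    linarith
  have hii := (mem_outS _ _ _).mpr (hadd i le_rfl)
  have hlow : ∀ p, (i, p) ∈ E → v p < avgS (outS E i) v →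
      ∀ k, (i, k) ∈ E → k ≠ i → k ≠ p → d i < d k := by
    intro p hp hvp k hk hki hkp
    by_contra! hdk
    have hkS : k ∈ (outS E i).erase p := Finset.mem_erase.mpr ⟨hkp, (mem_outS _ _ _).mpr hk⟩
    have h1 := avgS_erase (outS E i) v p ((mem_outS _ _ _).mpr hp) ⟨k, hkS⟩ hvp
    have h2 := hopt i hi _ k hkS hki hdk
    linarith
  obtain ⟨p, hpS, hvp⟩ := exists_low (outS E i) v i hii (hv i hi)
  have hpE := (mem_outS _ _ _).mp hpS
  have hyp : y = p := by
    by_contra hne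
    have := hlow p hpE hvp y hy hyi hne
    omega
  subst hyp
  have hvyi := lt_trans hvp (hv i hi)
  refine ⟨hadd, ?_, y, hy, hvyi, hyd, hlow y hy hvp⟩
  intro k hki hk
  apply hlow y hy hvp k (hadd k hk) hki
  rintro rfl
  linarith

theorem exists_sort {n : ℕ} (I : Finset (Fin n)) (v : Fin n → ℝ) (K : ℝ) (j : Fin n) (hj : j ∉ I)
    (hK : ∀ x, v x < K) (h1 : ∀ x ∈ I, 1 ≤ v x)
    (hIj : ∀ x ∈ I, v j < v x) (hjm : ∀ x, x ∉ I → v x ≤ v j)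
    (hinj : ∀ x ∈ I, ∀ y ∈ I, v x = v y → x = y) :
    ∃ φ : Fin n ≃ Fin n, (∀ k : Fin n, φ k ∈ I ↔ (k : ℕ) < I.card) ∧
      (∀ k : Fin n, (k : ℕ) = I.card → φ k = j) ∧
      (∀ k l : Fin n, k < l → (k : ℕ) < I.card → v (φ l) < v (φ k)) ∧
      (∀ k l : Fin n, k ≤ l → v (φ l) ≤ v (φ k)) := by
  classical
  set key : Fin n → ℝ := fun x => if x ∈ I then - v x else if x = j then 0 else 1 + K - v x
    with hkey
  set φ := Tuple.sort key with hφ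
  have hmono : Monotone (key ∘ φ) := Tuple.monotone_sort key
  have kI : ∀ x ∈ I, key x = - v x := fun x hx => by simp [hkey, hx]
  have kj : key j = 0 := by simp [hkey, hj]
  have ke : ∀ x, x ∉ I → x ≠ j → key x = 1 + K - v x := fun x hx hxj => by simp [hkey, hx, hxj]
  have c1 : ∀ x, key x ≤ -1 ↔ x ∈ I := by
    intro x
    by_cases hx : x ∈ I
    · simp only [hx, iff_true, kI x hx]; have := h1 x hx; linarith
    · by_cases hxj : x = j
      · subst hxj; simp only [kj, hx, iff_false]; norm_num
      · simp only [ke x hx hxj, hx, iff_false]; have := hK x; linarith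
  have c2 : ∀ x, key x ≤ 0 ↔ x ∈ insert j I := by
    intro x
    rw [Finset.mem_insert]
    by_cases hx : x ∈ I
    · simp only [hx, or_true, iff_true, kI x hx]; have := h1 x hx; linarith
    · by_cases hxj : x = j
      · subst hxj; simp only [kj, true_or, le_refl]
      · simp only [ke x hx hxj, hx, hxj, or_false, iff_false]; have := hK x; linarith
  have cardlem : ∀ (t : ℝ) (A : Finset (Fin n)), (∀ x, key x ≤ t ↔ x ∈ A) →
      ∀ k : Fin n, φ k ∈ A ↔ (k : ℕ) < A.card := by
    intro t A hA k
    have := Tuple.lt_card_le_iff_apply_le_of_monotone (f := key ∘ φ) (a := t) (j := k) hmono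
    have hc : (Finset.univ.filter (fun i => (key ∘ φ) i ≤ t)).card = A.card := by
      rw [← Fintype.card_subtype, ← Fintype.card_coe A]
      apply Fintype.card_congr
      exact φ.subtypeEquiv (fun a => by simp only [Function.comp]; exact hA _)
    rw [hc] at this
    rw [this, ← hA]; rfl
  have d1 := cardlem _ I c1
  have d2 := cardlem _ (insert j I) c2
  rw [Finset.card_insert_of_notMem hj] at d2
  have m2 : ∀ k l : Fin n, k ≤ l → v (φ l) ≤ v (φ k) := by
    intro k l hkl
    have hk : key (φ k) ≤ key (φ l) := hmono hkl
    by_cases hkI : φ k ∈ I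
    · by_cases hlI : φ l ∈ I
      · rw [kI _ hkI, kI _ hlI] at hk; linarith
      · have := hIj _ hkI; have := hjm _ hlI; linarith
    · have hlI : φ l ∉ I := by
        rw [d1] at hkI ⊢; have : (k : ℕ) ≤ l := hkl; omega
      by_cases hkj : φ k = j
      · rw [hkj]; exact hjm _ hlI
      · have hlj : φ l ≠ j := by
          intro h
          rw [h, kj, ke _ hkI hkj] at hk
          have := hK (φ k); linarith
        rw [ke _ hkI hkj, ke _ hlI hlj] at hk; linarith
  refine ⟨φ, d1, ?_, ?_, m2⟩
  · intro k hk
    have a1 : φ k ∈ insert j I := (d2 k).mpr (by omega)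
    have a2 : φ k ∉ I := by rw [d1]; omega
    exact (Finset.mem_insert.mp a1).resolve_right a2
  · intro k l hkl hk
    have hkI := (d1 k).mpr hk
    by_cases hlI : φ l ∈ I
    · refine lt_of_le_of_ne (m2 k l hkl.le) (fun h => ?_)
      have := φ.injective (hinj _ hlI _ hkI h)
      exact absurd this (ne_of_gt hkl)
    · have := hIj _ hkI; have := hjm _ hlI; linarith

/-- Theorem 12 (Optimal link structure): with `E_in(I)` and `E_Ī` fixed, every optimal
pair `(H, F)` admits a relabeling of the nodes under which `I = {1,…,n_I}`,
`v₁ > … > v_{n_I} > v_{n_I+1} ≥ … ≥ v_n`,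
`H = {(i,j) ∈ I×I : j ≤ i or j = i+1}` and `F = {(n_I, n_I+1)}`. -/
theorem stmt13 {n : ℕ} (hn : 1 ≤ n) (c : ℝ) (hc0 : 0 < c) (hc1 : c < 1)
    (z : Fin n → ℝ) (hz : ∀ i, 0 < z i) (hz1 : ∑ i, z i = 1)
    (I : Finset (Fin n)) (hI : I.Nonempty) (hIc : (Iᶜ : Finset (Fin n)).Nonempty)
    (Ein Eext : Finset (Fin n × Fin n))
    (hEin : ∀ p ∈ Ein, p.1 ∉ I ∧ p.2 ∈ I)
    (hEext : ∀ p ∈ Eext, p.1 ∉ I ∧ p.2 ∉ I)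
    (hout : ∀ i, i ∉ I → ∃ j, (i, j) ∈ Ein ∪ Eext)
    (H F : Finset (Fin n × Fin n))
    (hH : ∀ p ∈ H, p.1 ∈ I ∧ p.2 ∈ I) (hF : ∀ p ∈ F, p.1 ∈ I ∧ p.2 ∉ I)
    (hAdm : admissible (H ∪ F ∪ Ein ∪ Eext) I)
    (hOpt : ∀ H' F' : Finset (Fin n × Fin n),
      (∀ p ∈ H', p.1 ∈ I ∧ p.2 ∈ I) → (∀ p ∈ F', p.1 ∈ I ∧ p.2 ∉ I) →
      admissible (H' ∪ F' ∪ Ein ∪ Eext) I →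
      prSet c z (H' ∪ F' ∪ Ein ∪ Eext) I ≤ prSet c z (H ∪ F ∪ Ein ∪ Eext) I) :
    ∃ φ : Fin n ≃ Fin n,
      (∀ k : Fin n, φ k ∈ I ↔ (k : ℕ) < I.card) ∧
      (∀ k : Fin n, ∀ hk : (k : ℕ) + 1 < n,
        ((k : ℕ) + 1 ≤ I.card →
          vvec c (H ∪ F ∪ Ein ∪ Eext) I (φ ⟨(k : ℕ) + 1, hk⟩) <
            vvec c (H ∪ F ∪ Ein ∪ Eext) I (φ k)) ∧
        vvec c (H ∪ F ∪ Ein ∪ Eext) I (φ ⟨(k : ℕ) + 1, hk⟩) ≤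
          vvec c (H ∪ F ∪ Ein ∪ Eext) I (φ k)) ∧
      (∀ a b : Fin n, ((a, b) ∈ H ↔ ∃ k l : Fin n,
        (k : ℕ) < I.card ∧ (l : ℕ) < I.card ∧ a = φ k ∧ b = φ l ∧
          ((l : ℕ) ≤ (k : ℕ) ∨ (l : ℕ) = (k : ℕ) + 1))) ∧
      (∃ k l : Fin n, (k : ℕ) = I.card - 1 ∧ (l : ℕ) = I.card ∧
        F = {(φ k, φ l)}) := by
  classical
  set E := H ∪ F ∪ Ein ∪ Eext with hE
  obtain ⟨d, hd0, hd⟩ := exists_dist E I hAdm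
  obtain ⟨hvK, hv1, hva⟩ := v_bounds c hc0 hc1 E I hAdm d hd0 hd
  have hEH : ∀ a b, a ∈ I → b ∈ I → ((a, b) ∈ E ↔ (a, b) ∈ H) := by
    intro a b ha hb
    have h1 : (a, b) ∉ F := fun h => (hF _ h).2 hb
    have h2 : (a, b) ∉ Ein := fun h => (hEin _ h).1 ha
    have h3 : (a, b) ∉ Eext := fun h => (hEext _ h).1 ha
    simp [hE, h1, h2, h3]
  have hEF : ∀ a b, a ∈ I → b ∉ I → ((a, b) ∈ E ↔ (a, b) ∈ F) := by
    intro a b ha hb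
    have h1 : (a, b) ∉ H := fun h => hb (hH _ h).2
    have h2 : (a, b) ∉ Ein := fun h => (hEin _ h).1 ha
    have h3 : (a, b) ∉ Eext := fun h => (hEext _ h).1 ha
    simp [hE, h1, h2, h3]
  have hopt : ∀ i ∈ I, ∀ S : Finset (Fin n), ∀ k ∈ S, k ≠ i → d k ≤ d i →
      avgS S (vvec c E I) ≤ avgS (outS E i) (vvec c E I) := by
    intro i hi S k hk hki hdk
    have hA' := adm_chg E I hAdm d hd0 hd i S k hk hki hdk
    apply chg_le c hc0 hc1 z hz E I hAdm i S hA'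
    have hEq : (chg E i S).filter (fun q => q.1 ∈ I ∧ q.2 ∈ I) ∪
        (chg E i S).filter (fun q => q.1 ∈ I ∧ q.2 ∉ I) ∪ Ein ∪ Eext = chg E i S := by
      ext ⟨a, b⟩
      simp only [Finset.mem_union, Finset.mem_filter]
      by_cases ha : a ∈ I
      · have h2 : (a, b) ∉ Ein := fun h => (hEin _ h).1 ha
        have h3 : (a, b) ∉ Eext := fun h => (hEext _ h).1 ha
        simp only [ha, h2, h3]
        tauto
      · have hai : a ≠ i := by rintro rfl; exact ha hi
        have h1 : (a, b) ∉ H := fun h => ha (hH _ h).1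
        have h2 : (a, b) ∉ F := fun h => ha (hF _ h).1
        have h3 : (a, b) ∈ chg E i S ↔ (a, b) ∈ Ein ∨ (a, b) ∈ Eext := by
          simp [chg, hai, hE, h1, h2]
        simp only [ha, h3]
        tauto
    have := hOpt ((chg E i S).filter (fun q => q.1 ∈ I ∧ q.2 ∈ I))
      ((chg E i S).filter (fun q => q.1 ∈ I ∧ q.2 ∉ I))
      (fun p hp => (Finset.mem_filter.mp hp).2) (fun p hp => (Finset.mem_filter.mp hp).2)
    rw [hEq] at this
    exact this hA'
  set v := vvec c E I with hvdef
  have hst := opt_shape E I v d hd hva hopt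
  have hinj : ∀ x ∈ I, ∀ y ∈ I, v x = v y → x = y := by
    intro x hx y hy hxy
    by_contra hne
    have h1 := (hst x hx).2.1 y (Ne.symm hne) hxy.le
    have h2 := (hst y hy).2.1 x hne hxy.ge
    omega
  have hext : ∀ x ∈ I, ∀ y, y ∉ I → v y < v x := by
    intro x hx y hy
    by_contra! h
    have h1 := (hst x hx).2.1 y (by rintro rfl; exact hy hx) h
    have h2 := (hd0 y).mpr hy
    omega
  obtain ⟨i0, hi0, hmin⟩ := Finset.exists_min_image I v hI
  obtain ⟨-, hi0d, j, hjE, hjv, hjd, hjl⟩ := hst i0 hi0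
  have hjI : j ∉ I := by
    intro h
    have := hmin j h
    linarith
  have hdj := (hd0 j).mpr hjI
  have hFeq : F = {(i0, j)} := by
    ext ⟨a, b⟩
    rw [Finset.mem_singleton]
    constructor
    · intro h
      obtain ⟨ha, hb⟩ := hF _ h
      have ha' : a ∈ I := ha
      have hb' : b ∉ I := hb
      have hdb := (hd0 b).mpr hb'
      have habE := (hEF a b ha' hb').mpr h
      have hba : b ≠ a := by rintro rfl; exact hb' ha'
      obtain ⟨-, -, p, hpE, hpv, hpd, hpl⟩ := hst a ha'
      have hbp : b = p := by
        by_contra hne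
        have := hpl b habE hba hne
        omega
      have hai : a = i0 := by
        by_contra hne
        have := hi0d a hne (hmin a ha')
        rw [← hbp] at hpd
        omega
      subst hai
      have hbj : b = j := by
        by_contra hne
        have := hjl b habE hba hne
        omega
      rw [hbj]
    · intro h
      rw [h]
      exact (hEF i0 j hi0 hjI).mp hjE
  have hjm : ∀ x, x ∉ I → v x ≤ v j := by
    intro b hb
    by_contra! hlt
    have hbE : b ∉ outS E i0 := by
      rw [mem_outS, hEF i0 b hi0 hb, hFeq]
      simp only [Finset.mem_singleton, Prod.mk.injEq, true_and]
      rintro rfl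
      exact lt_irrefl _ hlt
    have h1 := avgS_swap (outS E i0) v j b ((mem_outS _ _ _).mpr hjE) hbE hlt
    have h2 := hopt i0 hi0 _ b (Finset.mem_insert_self b ((outS E i0).erase j))
      (by rintro rfl; exact hb hi0) (by have := (hd0 b).mpr hb; omega)
    linarith
  obtain ⟨φ, f1, f2, f3, f4⟩ := exists_sort I v _ j hjI hvK hv1 (fun x hx => hext x hx j hjI) hjm hinj
  have hcard : I.card < n := by
    have := Finset.card_lt_univ_of_notMem hjI
    simpa using this
  have hcpos : 0 < I.card := hI.card_pos
  -- distances decrease along the order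
  have hdd : ∀ k l : Fin n, k < l → (l : ℕ) < I.card → d (φ l) < d (φ k) := by
    intro k l hkl hl
    have hkl' : (k : ℕ) < l := hkl
    refine (hst (φ l) ((f1 l).mpr hl)).2.1 (φ k) ?_ (f4 k l hkl.le)
    intro h
    exact absurd (φ.injective h) (ne_of_lt hkl)
  have hHl : ∀ k l : Fin n, (k : ℕ) < I.card → (l : ℕ) < I.card →
      ((φ k, φ l) ∈ E ↔ ((l : ℕ) ≤ k ∨ (l : ℕ) = k + 1)) := by
    intro k l hk hl
    obtain ⟨hadd, -, p, hpE, hpv, hpd, hpl⟩ := hst (φ k) ((f1 k).mpr hk)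
    constructor
    · intro h
      by_contra! hcon
      have hkl : k < l := by show (k : ℕ) < l; omega
      have hne : φ l ≠ φ k := fun h => absurd (φ.injective h) (ne_of_gt hkl)
      have hd1 := hdd k l hkl hl
      have hlp : φ l = p := by
        by_contra hlp
        have := hpl _ h hne hlp
        omega
      rw [← hlp] at hpd
      have e1 := hdd k ⟨k + 1, by omega⟩ (by show (k : ℕ) < k + 1; omega)
        (by show (k : ℕ) + 1 < _; omega)
      have e2 := hdd ⟨k + 1, by omega⟩ l (by show (k : ℕ) + 1 < l; omega) hl
      omega
    · rintro (h | h)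
      · exact hadd _ (f4 l k h)
      · have hkl : k < l := by show (k : ℕ) < l; omega
        have e1 := hdd k l hkl hl
        obtain ⟨m, rfl⟩ := φ.surjective p
        have hmI : φ m ∈ I := by
          by_contra hm
          have z1 := (hd0 _).mpr hm
          have z2 : d (φ l) = 0 := by omega
          exact (hd0 _).mp z2 ((f1 l).mpr hl)
        have hm := (f1 m).mp hmI
        have hml : m = l := by
          rcases lt_trichotomy m l with h1 | h1 | h1
          · have h1' : (m : ℕ) < l := h1
            have : m ≤ k := by show (m : ℕ) ≤ k; omega
            have := f4 m k this
            linarith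
          · exact h1
          · have := hdd l m h1 hm
            omega
        rw [← hml]; exact hpE
  refine ⟨φ, f1, ?_, ?_, ?_⟩
  · intro k hk
    have hlt : k < (⟨(k : ℕ) + 1, hk⟩ : Fin n) := by show (k : ℕ) < k + 1; omega
    exact ⟨fun h => f3 k _ hlt (by omega), f4 k _ hlt.le⟩
  · intro a b
    constructor
    · intro h
      obtain ⟨ha, hb⟩ := hH _ h
      have ha' : a ∈ I := ha
      have hb' : b ∈ I := hb
      obtain ⟨k, rfl⟩ := φ.surjective a
      obtain ⟨l, rfl⟩ := φ.surjective b
      have hk := (f1 k).mp ha'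
      have hl := (f1 l).mp hb'
      exact ⟨k, l, hk, hl, rfl, rfl, (hHl k l hk hl).mp ((hEH _ _ ha' hb').mpr h)⟩
    · rintro ⟨k, l, hk, hl, rfl, rfl, h⟩
      exact (hEH _ _ ((f1 k).mpr hk) ((f1 l).mpr hl)).mp ((hHl k l hk hl).mpr h)
  · refine ⟨⟨I.card - 1, by omega⟩, ⟨I.card, hcard⟩, rfl, rfl, ?_⟩
    rw [hFeq, f2 ⟨I.card, hcard⟩ rfl]
    have : i0 = φ ⟨I.card - 1, by omega⟩ := by
      obtain ⟨k, rfl⟩ := φ.surjective i0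
      have hk := (f1 k).mp hi0
      by_contra hne
      have hkne : (k : ℕ) ≠ I.card - 1 := by
        intro h
        apply hne
        congr 1
        exact Fin.ext h
      have h1 := f3 k ⟨I.card - 1, by omega⟩ (by show (k : ℕ) < I.card - 1; omega) hk
      have h2 := hmin (φ ⟨I.card - 1, by omega⟩) ((f1 _).mpr (by show I.card - 1 < _; omega))
      linarith
    rw [this]
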